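/- arXiv:2406.14063 — 3 statements merged into one kernel-verified Lean document; each statement's English description precedes it below -/
import Mathlib

section
/- Let Ω ⊂ ℝⁿ (n ≥ 3) be a bounded open set, let γ be a conductivity on the closure of Ω, and let Ψ be a smooth diffeomorphism of the closure of Ω onto itself. Let λ ∈ ℝ and let u be a C¹ function on the closure of Ω which is a weak solution of −div((Ψ_*γ)∇u) = λu on Ω, i.e. ∫_Ω ((Ψ_*γ)∇u)·∇v dy = λ ∫_Ω u v dy for every smooth compactly supported v : Ω → ℝ. Then ũ := u∘Ψ is a weak solution of −div(γ∇ũ) = λ |det DΨ| ũ on Ω, i.e. ∫_Ω (γ∇ũ)·∇w dx = λ ∫_Ω |det DΨ(x)| ũ(x) w(x) dx for every smooth compactly supported w : Ω → ℝ. -/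
open MeasureTheory Matrix Set Filter
open scoped Topology

noncomputable section

/-- The gradient of a scalar function on `ℝⁿ`, as a vector of partial derivatives. -/
def grad {n : ℕ} (u : (Fin n → ℝ) → ℝ) (x : Fin n → ℝ) : Fin n → ℝ :=
  fun i => fderiv ℝ u x (Pi.single i 1)

/-- The Jacobian matrix `(DΨ)_{ij} = ∂Ψ_i/∂x_j` of a map `Ψ : ℝⁿ → ℝⁿ`. -/
def Jac {n : ℕ} (Ψ : (Fin n → ℝ) → (Fin n → ℝ)) (x : Fin n → ℝ) :
    Matrix (Fin n) (Fin n) ℝ :=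
  Matrix.of fun i j => fderiv ℝ (fun y => Ψ y i) x (Pi.single j 1)

/-- A conductivity on a set `s`: a continuous map from `s` to the positive-definite
symmetric real `n × n` matrices. -/
def IsConductivityOn {n : ℕ} (γ : (Fin n → ℝ) → Matrix (Fin n) (Fin n) ℝ)
    (s : Set (Fin n → ℝ)) : Prop :=
  (∀ i j, ContinuousOn (fun x => γ x i j) s) ∧ ∀ x ∈ s, (γ x).IsSymm ∧ (γ x).PosDef

/-- The pushforward conductivity `Ψ_*γ = ((DΨ · γ · (DΨ)ᵀ)/|det DΨ|) ∘ Ψ⁻¹`, where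
`Φ` denotes the inverse of `Ψ`. -/
def pushforward {n : ℕ} (Ψ Φ : (Fin n → ℝ) → (Fin n → ℝ))
    (γ : (Fin n → ℝ) → Matrix (Fin n) (Fin n) ℝ) (y : Fin n → ℝ) :
    Matrix (Fin n) (Fin n) ℝ :=
  |(Jac Ψ (Φ y)).det|⁻¹ • (Jac Ψ (Φ y) * γ (Φ y) * (Jac Ψ (Φ y))ᵀ)

/-- A `C^k` diffeomorphism of the closure of `Ω` onto itself (restricting to a
diffeomorphism of `Ω` onto itself). -/
structure DiffeoOn {n : ℕ} (k : ℕ∞) (Ω : Set (Fin n → ℝ)) where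
  toFun : (Fin n → ℝ) → (Fin n → ℝ)
  invFun : (Fin n → ℝ) → (Fin n → ℝ)
  contDiffOn_toFun : ContDiffOn ℝ k toFun (closure Ω)
  contDiffOn_invFun : ContDiffOn ℝ k invFun (closure Ω)
  maps_toFun : MapsTo toFun (closure Ω) (closure Ω)
  maps_invFun : MapsTo invFun (closure Ω) (closure Ω)
  left_inv : ∀ x ∈ closure Ω, invFun (toFun x) = x
  right_inv : ∀ y ∈ closure Ω, toFun (invFun y) = y
  image_eq : toFun '' Ω = Ω

/-- A smooth test function compactly supported in `Ω`. -/
def IsTestFun {n : ℕ} (Ω : Set (Fin n → ℝ)) (v : (Fin n → ℝ) → ℝ) : Prop :=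
  ContDiff ℝ (⊤ : ℕ∞) v ∧ HasCompactSupport v ∧ tsupport v ⊆ Ω

/-- The divergence `div F = ∑ᵢ ∂Fᵢ/∂xᵢ` of a vector field on `ℝⁿ`. -/
def diverg {n : ℕ} (F : (Fin n → ℝ) → (Fin n → ℝ)) (x : Fin n → ℝ) : ℝ :=
  ∑ i, fderiv ℝ (fun y => F y i) x (Pi.single i 1)
theorem grad_dotProduct {n : ℕ} (u : (Fin n → ℝ) → ℝ) (x a : Fin n → ℝ) :
    grad u x ⬝ᵥ a = fderiv ℝ u x a := by
  conv_rhs => rw [pi_eq_sum_univ' a, map_sum]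
  refine Finset.sum_congr rfl fun i _ => ?_
  rw [map_smul, smul_eq_mul, mul_comm]
  simp only [grad]

theorem Jac_eq_toMatrix' {n : ℕ} {F : (Fin n → ℝ) → (Fin n → ℝ)} {x : Fin n → ℝ}
    (hF : DifferentiableAt ℝ F x) :
    Jac F x = LinearMap.toMatrix' (fderiv ℝ F x : (Fin n → ℝ) →ₗ[ℝ] (Fin n → ℝ)) := by
  ext i j
  simp only [Jac, Matrix.of_apply, LinearMap.toMatrix'_apply, ContinuousLinearMap.coe_coe]
  rw [fderiv_apply hF i]
  simp

theorem det_Jac {n : ℕ} {F : (Fin n → ℝ) → (Fin n → ℝ)} {x : Fin n → ℝ}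
    (hF : DifferentiableAt ℝ F x) : (Jac F x).det = (fderiv ℝ F x).det := by
  rw [Jac_eq_toMatrix' hF, LinearMap.det_toMatrix']

theorem grad_comp {n : ℕ} {F : (Fin n → ℝ) → (Fin n → ℝ)} {u : (Fin n → ℝ) → ℝ}
    {x : Fin n → ℝ} (hu : DifferentiableAt ℝ u (F x)) (hF : DifferentiableAt ℝ F x) :
    grad (u ∘ F) x = (Jac F x)ᵀ *ᵥ grad u (F x) := by
  ext j
  have h : (Jac F x)ᵀ j = fderiv ℝ F x (Pi.single j 1) := by
    ext i
    simp [Jac, fderiv_apply hF i]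
  rw [Matrix.mulVec, h, dotProduct_comm, grad_dotProduct, grad, fderiv_comp x hu hF]
  rfl

theorem det_fderiv_ne_zero_of_leftInverse {n : ℕ} {F G : (Fin n → ℝ) → (Fin n → ℝ)}
    {x : Fin n → ℝ} (hF : DifferentiableAt ℝ F x) (hG : DifferentiableAt ℝ G (F x))
    (h : G ∘ F =ᶠ[𝓝 x] id) : (fderiv ℝ F x).det ≠ 0 := by
  have hc : (fderiv ℝ G (F x)).comp (fderiv ℝ F x) = ContinuousLinearMap.id ℝ _ := by
    rw [← fderiv_comp x hG hF, h.fderiv_eq, fderiv_id]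
  have hd : (fderiv ℝ G (F x)).det * (fderiv ℝ F x).det = 1 := by
    have := congrArg ContinuousLinearMap.det hc
    simpa [ContinuousLinearMap.det, LinearMap.det_comp] using this
  exact right_ne_zero_of_mul_eq_one hd

/-- The defining identity of the pushforward conductivity, at the level of quadratic forms. -/
theorem abs_det_mul_pushforward_mulVec_dotProduct {n : ℕ} {Ψ Φ : (Fin n → ℝ) → (Fin n → ℝ)}
    (γ : (Fin n → ℝ) → Matrix (Fin n) (Fin n) ℝ) {x : Fin n → ℝ} (hΦ : Φ (Ψ x) = x)
    (hdet : (Jac Ψ x).det ≠ 0) (a b : Fin n → ℝ) :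
    |(Jac Ψ x).det| * (pushforward Ψ Φ γ (Ψ x) *ᵥ a ⬝ᵥ b) =
      γ x *ᵥ ((Jac Ψ x)ᵀ *ᵥ a) ⬝ᵥ ((Jac Ψ x)ᵀ *ᵥ b) := by
  rw [pushforward, hΦ, Matrix.smul_mulVec, smul_dotProduct, smul_eq_mul,
    mul_inv_cancel_left₀ (abs_ne_zero.mpr hdet), ← Matrix.mulVec_mulVec,
    ← Matrix.mulVec_mulVec, Matrix.mulVec_transpose _ b, dotProduct_comm,
    Matrix.dotProduct_mulVec, dotProduct_comm]

namespace DiffeoOn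

variable {n : ℕ} {k : ℕ∞} {Ω : Set (Fin n → ℝ)}

theorem toFun_mem (Ψ : DiffeoOn k Ω) {x : Fin n → ℝ} (hx : x ∈ Ω) : Ψ.toFun x ∈ Ω :=
  Ψ.image_eq.subset (mem_image_of_mem _ hx)

theorem contDiffAt_toFun (Ψ : DiffeoOn k Ω) (hΩ : IsOpen Ω) {x : Fin n → ℝ} (hx : x ∈ Ω) :
    ContDiffAt ℝ k Ψ.toFun x :=
  Ψ.contDiffOn_toFun.contDiffAt (mem_of_superset (hΩ.mem_nhds hx) subset_closure)

theorem contDiffAt_invFun (Ψ : DiffeoOn k Ω) (hΩ : IsOpen Ω) {y : Fin n → ℝ} (hy : y ∈ Ω) :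
    ContDiffAt ℝ k Ψ.invFun y :=
  Ψ.contDiffOn_invFun.contDiffAt (mem_of_superset (hΩ.mem_nhds hy) subset_closure)

theorem injOn_toFun (Ψ : DiffeoOn k Ω) : InjOn Ψ.toFun Ω := fun x hx y hy h => by
  rw [← Ψ.left_inv x (subset_closure hx), h, Ψ.left_inv y (subset_closure hy)]

theorem det_Jac_ne_zero (Ψ : DiffeoOn k Ω) (hk : k ≠ 0) (hΩ : IsOpen Ω) {x : Fin n → ℝ}
    (hx : x ∈ Ω) : (Jac Ψ.toFun x).det ≠ 0 := by
  have hk' : (k : WithTop ℕ∞) ≠ 0 := by exact_mod_cast hk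
  have hd := (Ψ.contDiffAt_toFun hΩ hx).differentiableAt hk'
  rw [det_Jac hd]
  refine det_fderiv_ne_zero_of_leftInverse hd
    ((Ψ.contDiffAt_invFun hΩ (Ψ.toFun_mem hx)).differentiableAt hk') ?_
  filter_upwards [hΩ.mem_nhds hx] with y hy using Ψ.left_inv y (subset_closure hy)

/-- Change of variables under a diffeomorphism of `Ω`. -/
theorem setIntegral_eq (Ψ : DiffeoOn k Ω) (hk : k ≠ 0) (hΩ : IsOpen Ω)
    (f : (Fin n → ℝ) → ℝ) :
    ∫ y in Ω, f y = ∫ x in Ω, |(Jac Ψ.toFun x).det| * f (Ψ.toFun x) := by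
  have hk' : (k : WithTop ℕ∞) ≠ 0 := by exact_mod_cast hk
  have hd : ∀ x ∈ Ω, DifferentiableAt ℝ Ψ.toFun x := fun x hx =>
    (Ψ.contDiffAt_toFun hΩ hx).differentiableAt hk'
  have h := integral_image_eq_integral_abs_det_fderiv_smul volume hΩ.measurableSet
    (fun x hx => (hd x hx).hasFDerivAt.hasFDerivWithinAt) Ψ.injOn_toFun f
  rw [Ψ.image_eq] at h
  rw [h]
  refine setIntegral_congr_fun hΩ.measurableSet fun x hx => ?_
  simp only [det_Jac (hd x hx), smul_eq_mul]

/-- Test functions transport along the inverse of a diffeomorphism, extended by zero. -/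
theorem isTestFun_indicator_comp_invFun (Ψ : DiffeoOn ⊤ Ω) (hΩ : IsOpen Ω)
    {w : (Fin n → ℝ) → ℝ} (hw : IsTestFun Ω w) :
    IsTestFun Ω (Ω.indicator (w ∘ Ψ.invFun)) := by
  obtain ⟨hws, hwc, hwΩ⟩ := hw
  set K := Ψ.toFun '' tsupport w with hK
  have hKc : IsCompact K := hwc.isCompact.image_of_continuousOn
    (Ψ.contDiffOn_toFun.continuousOn.mono (hwΩ.trans subset_closure))
  have hKΩ : K ⊆ Ω := (image_mono hwΩ).trans Ψ.image_eq.subset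
  have h0 : ∀ z ∉ K, Ω.indicator (w ∘ Ψ.invFun) z = 0 := by
    intro z hz
    by_cases hzΩ : z ∈ Ω
    · rw [indicator_of_mem hzΩ, Function.comp_apply]
      refine image_eq_zero_of_notMem_tsupport fun hmem => hz ?_
      exact ⟨_, hmem, Ψ.right_inv z (subset_closure hzΩ)⟩
    · exact indicator_of_notMem hzΩ _
  have hsupp : tsupport (Ω.indicator (w ∘ Ψ.invFun)) ⊆ K :=
    closure_minimal (fun z hz => by_contra fun hzK => hz (h0 z hzK)) hKc.isClosed
  refine ⟨contDiff_iff_contDiffAt.mpr fun y => ?_, HasCompactSupport.intro hKc h0,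
    hsupp.trans hKΩ⟩
  by_cases hy : y ∈ Ω
  · refine (hws.contDiffAt.comp y (Ψ.contDiffAt_invFun hΩ hy)).congr_of_eventuallyEq ?_
    filter_upwards [hΩ.mem_nhds hy] with z hz using indicator_of_mem hz _
  · refine (contDiffAt_const (c := (0 : ℝ))).congr_of_eventuallyEq ?_
    filter_upwards [hKc.isClosed.isOpen_compl.mem_nhds fun h => hy (hKΩ h)] with z hz
      using h0 z hz

end DiffeoOn

/-- If `u` (of class `C¹` on the closure of `Ω`) is a weak solution of
`−div((Ψ_*γ)∇u) = λu` on `Ω`, where `Ψ` is a smooth diffeomorphism of the closure of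
`Ω` onto itself, then `ũ := u ∘ Ψ` is a weak solution of
`−div(γ∇ũ) = λ |det DΨ| ũ` on `Ω`. -/
theorem weak_solution_pullback
    {n : ℕ} (hn : 3 ≤ n) (Ω : Set (Fin n → ℝ)) (hΩo : IsOpen Ω)
    (hΩb : Bornology.IsBounded Ω)
    (γ : (Fin n → ℝ) → Matrix (Fin n) (Fin n) ℝ)
    (hγ : IsConductivityOn γ (closure Ω))
    (Ψ : DiffeoOn ⊤ Ω) (lam : ℝ)
    (u : (Fin n → ℝ) → ℝ) (hu : ContDiffOn ℝ 1 u (closure Ω))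
    (hweak : ∀ v : (Fin n → ℝ) → ℝ, IsTestFun Ω v →
      ∫ y in Ω, (pushforward Ψ.toFun Ψ.invFun γ y).mulVec (grad u y) ⬝ᵥ grad v y
        = lam * ∫ y in Ω, u y * v y) :
    ∀ w : (Fin n → ℝ) → ℝ, IsTestFun Ω w →
      ∫ x in Ω, (γ x).mulVec (grad (u ∘ Ψ.toFun) x) ⬝ᵥ grad w x
        = lam * ∫ x in Ω, |(Jac Ψ.toFun x).det| * (u (Ψ.toFun x) * w x) := by
  intro w hw
  have hv := Ψ.isTestFun_indicator_comp_invFun hΩo hw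
  set v := Ω.indicator (w ∘ Ψ.invFun) with hv_def
  have hvw : ∀ x ∈ Ω, v (Ψ.toFun x) = w x := fun x hx => by
    rw [hv_def, indicator_of_mem (Ψ.toFun_mem hx), Function.comp_apply,
      Ψ.left_inv x (subset_closure hx)]
  have h := hweak v hv
  rw [Ψ.setIntegral_eq (by simp) hΩo,
    Ψ.setIntegral_eq (by simp) hΩo fun y => u y * v y] at h
  convert h using 1
  · refine setIntegral_congr_fun hΩo.measurableSet fun x hx => ?_
    have hΨx := Ψ.toFun_mem hx
    have hF := (Ψ.contDiffAt_toFun hΩo hx).differentiableAt (by simp)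
    have hux : DifferentiableAt ℝ u (Ψ.toFun x) :=
      (hu.contDiffAt (mem_of_superset (hΩo.mem_nhds hΨx) subset_closure)).differentiableAt
        (by simp)
    have hvx : DifferentiableAt ℝ v (Ψ.toFun x) :=
      hv.1.contDiffAt.differentiableAt (by simp)
    have hgw : grad w x = grad (v ∘ Ψ.toFun) x := by
      have he : w =ᶠ[𝓝 x] v ∘ Ψ.toFun := by
        filter_upwards [hΩo.mem_nhds hx] with z hz using (hvw z hz).symm
      ext i
      rw [grad, grad, he.fderiv_eq]
    simp only [abs_det_mul_pushforward_mulVec_dotProduct γ (Ψ.left_inv x (subset_closure hx))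
      (Ψ.det_Jac_ne_zero (by simp) hΩo hx), hgw, grad_comp hux hF, grad_comp hvx hF]
  · congr 1
    refine setIntegral_congr_fun hΩo.measurableSet fun x hx => ?_
    simp only [hvw x hx]
end
end

section
/- Let Ω ⊂ ℝⁿ (n ≥ 3) be a nonempty bounded open set and let γ be a conductivity on the closure of Ω. Then for every u₀ ∈ X_∞ and every real number λ ≥ Q_γ(u₀), there exists u ∈ X_∞ with Q_γ(u) = λ. -/
open MeasureTheory Matrix Set Filter
open scoped Topology

noncomputable section

/-- `X_∞`: smooth compactly supported functions in `Ω`, `L²`-normalized and with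
zero mean. -/
def MemXinf {n : ℕ} (Ω : Set (Fin n → ℝ)) (u : (Fin n → ℝ) → ℝ) : Prop :=
  ContDiff ℝ (⊤ : ℕ∞) u ∧ HasCompactSupport u ∧ tsupport u ⊆ Ω ∧
    (∫ x in Ω, (u x) ^ 2) = 1 ∧ (∫ x in Ω, u x) = 0

/-- The Dirichlet quadratic form `Q_γ(u) = ∫_Ω (γ∇u)·∇u dx`. -/
def Qform {n : ℕ} (Ω : Set (Fin n → ℝ)) (γ : (Fin n → ℝ) → Matrix (Fin n) (Fin n) ℝ)
    (u : (Fin n → ℝ) → ℝ) : ℝ :=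
  ∫ x in Ω, (γ x).mulVec (grad u x) ⬝ᵥ grad u x

lemma exists_root_of_neg_of_pos {a b c : ℝ} (ha : 0 < a) (hc : c < 0) (d : ℝ) :
    ∃ t : ℝ, 0 ≤ t * d ∧ a * t ^ 2 + b * t + c = 0 := by
  have hac : 0 < -(4 * a * c) := by nlinarith
  set r := Real.sqrt (b ^ 2 - 4 * a * c) with hr
  have hr2 : r ^ 2 = b ^ 2 - 4 * a * c := Real.sq_sqrt (by nlinarith [sq_nonneg b])
  have hbr : |b| ≤ r := Real.abs_le_sqrt (by linarith)
  obtain ⟨h1, h2⟩ := abs_le.mp hbr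
  rcases le_total 0 d with hd | hd
  · refine ⟨(-b + r) / (2 * a), mul_nonneg (div_nonneg (by linarith) (by linarith)) hd, ?_⟩
    field_simp
    linear_combination hr2
  · refine ⟨(-b - r) / (2 * a), mul_nonneg_of_nonpos_of_nonpos
      (div_nonpos_of_nonpos_of_nonneg (by linarith) (by linarith)) hd, ?_⟩
    field_simp
    linear_combination hr2

section Gradient

variable {n : ℕ} {u v : (Fin n → ℝ) → ℝ}

lemma continuous_grad (hu : ContDiff ℝ (⊤ : ℕ∞) u) : Continuous (grad u) := by
  refine continuous_pi fun i => ?_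
  exact (hu.continuous_fderiv (by simp)).clm_apply continuous_const

lemma grad_add_const_mul (hu : Differentiable ℝ u) (hv : Differentiable ℝ v) (t : ℝ) :
    grad (fun x => u x + t * v x) = fun x => grad u x + t • grad v x := by
  ext x i
  have h := (hu x).hasFDerivAt.add ((hv x).hasFDerivAt.const_mul t)
  have h' : HasFDerivAt (fun x => u x + t * v x) (fderiv ℝ u x + t • fderiv ℝ v x) x := h
  simp [grad, h'.fderiv]

lemma grad_const_mul (hu : Differentiable ℝ u) (t : ℝ) :
    grad (fun x => t * u x) = fun x => t • grad u x := by
  ext x i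
  simp [grad, ((hu x).hasFDerivAt.const_mul t).fderiv]

lemma grad_comp_smul_sub (hu : Differentiable ℝ u) (k : ℝ) (x₀ : Fin n → ℝ) :
    grad (fun x => u (k • (x - x₀))) = fun x => k • grad u (k • (x - x₀)) := by
  ext x i
  have h1 : HasFDerivAt (fun x : Fin n → ℝ => k • (x - x₀))
      (k • ContinuousLinearMap.id ℝ (Fin n → ℝ)) x :=
    ((hasFDerivAt_id x).sub_const x₀).const_smul k
  have h := (hu (k • (x - x₀))).hasFDerivAt.comp x h1
  have h' : HasFDerivAt (fun x => u (k • (x - x₀)))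
      ((fderiv ℝ u (k • (x - x₀))).comp (k • ContinuousLinearMap.id ℝ (Fin n → ℝ))) x := h
  simp [grad, h'.fderiv]

lemma support_grad_subset : Function.support (grad u) ⊆ tsupport u := by
  intro x hx
  by_contra hxu
  apply hx
  have : fderiv ℝ u x = 0 := by
    by_contra h
    exact hxu (support_fderiv_subset ℝ h)
  ext i
  simp [grad, this]

lemma fderiv_eq_zero_of_grad_eq_zero {x : Fin n → ℝ} (h : grad u x = 0) :
    fderiv ℝ u x = 0 := by
  apply ContinuousLinearMap.coe_injective
  refine (Pi.basisFun ℝ (Fin n)).ext fun i => ?_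
  simpa [grad] using congrFun h i

lemma integral_norm_grad_sq_pos (hn : 0 < n) (hu : ContDiff ℝ (⊤ : ℕ∞) u)
    (hc : HasCompactSupport u) (hne : u ≠ 0) : 0 < ∫ x, ‖grad u x‖ ^ 2 := by
  have : Nonempty (Fin n) := ⟨⟨0, hn⟩⟩
  have : NoncompactSpace (Fin n → ℝ) := NormedSpace.noncompactSpace ℝ (Fin n → ℝ)
  have hg : ∃ x, grad u x ≠ 0 := by
    by_contra! h
    apply hne
    obtain ⟨y, hy⟩ := (Set.ne_univ_iff_exists_notMem _).mp hc.isCompact.ne_univ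
    ext x
    rw [is_const_of_fderiv_eq_zero (hu.differentiable (by simp))
      (fun z => fderiv_eq_zero_of_grad_eq_zero (h z)) x y, image_eq_zero_of_notMem_tsupport hy]
    rfl
  obtain ⟨x, hx⟩ := hg
  refine Continuous.integral_pos_of_hasCompactSupport_nonneg_nonzero (x := x)
    ((continuous_grad hu).norm.pow 2) ?_ (fun y => by positivity) (by simpa using hx)
  refine HasCompactSupport.intro hc.isCompact fun y hy => ?_
  have : grad u y = 0 := by
    by_contra h
    exact hy (support_grad_subset h)
  simp [this]

end Gradient

section Conductivity

variable {n : ℕ} {Ω : Set (Fin n → ℝ)} {γ : (Fin n → ℝ) → Matrix (Fin n) (Fin n) ℝ}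
  {u v : (Fin n → ℝ) → ℝ}

lemma IsConductivityOn.continuousOn_form {s : Set (Fin n → ℝ)} (hγ : IsConductivityOn γ s)
    {X : Type*} [TopologicalSpace X] {t : Set X} {p f g : X → Fin n → ℝ}
    (hp : ContinuousOn p t) (hps : MapsTo p t s) (hf : ContinuousOn f t)
    (hg : ContinuousOn g t) :
    ContinuousOn (fun x => (γ (p x)).mulVec (f x) ⬝ᵥ g x) t := by
  simp only [dotProduct, mulVec]
  refine continuousOn_finsetSum _ fun i _ => ContinuousOn.mul ?_ (continuousOn_pi.mp hg i)
  exact continuousOn_finsetSum _ fun j _ =>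
    ((hγ.1 i j).comp hp hps).mul (continuousOn_pi.mp hf j)

lemma IsConductivityOn.exists_lower_bound {s : Set (Fin n → ℝ)} (hγ : IsConductivityOn γ s)
    (hs : IsCompact s) :
    ∃ c : ℝ, 0 < c ∧ ∀ x ∈ s, ∀ w : Fin n → ℝ, c * ‖w‖ ^ 2 ≤ (γ x).mulVec w ⬝ᵥ w := by
  have hcont : ContinuousOn (fun q : (Fin n → ℝ) × (Fin n → ℝ) => (γ q.1).mulVec q.2 ⬝ᵥ q.2)
      (s ×ˢ Metric.sphere 0 1) :=
    hγ.continuousOn_form continuousOn_fst (fun q hq => hq.1) continuousOn_snd continuousOn_snd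
  have hpos : ∀ q ∈ s ×ˢ Metric.sphere (0 : Fin n → ℝ) 1, 0 < (γ q.1).mulVec q.2 ⬝ᵥ q.2 := by
    rintro ⟨x, w⟩ ⟨hx, hw⟩
    have hw0 : w ≠ 0 := by
      rintro rfl
      simp at hw
    have := (hγ.2 x hx).2.dotProduct_mulVec_pos hw0
    rwa [star_trivial, dotProduct_comm] at this
  obtain ⟨c, hc, hcq⟩ := (hs.prod (isCompact_sphere (0 : Fin n → ℝ) 1)).exists_forall_le'
    hcont hpos
  refine ⟨c, hc, fun x hx w => ?_⟩
  rcases eq_or_ne w 0 with rfl | hw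
  · simp
  have hw' : ‖w‖ ≠ 0 := norm_ne_zero_iff.mpr hw
  have h := hcq (x, ‖w‖⁻¹ • w) ⟨hx, by simp [norm_smul, hw']⟩
  simp only [mulVec_smul, smul_dotProduct, dotProduct_smul, smul_eq_mul] at h
  have h2 := mul_le_mul_of_nonneg_right h (sq_nonneg ‖w‖)
  field_simp at h2
  linarith

lemma integrableOn_form (hΩb : Bornology.IsBounded Ω) (hγ : IsConductivityOn γ (closure Ω))
    (hu : ContDiff ℝ (⊤ : ℕ∞) u) (hv : ContDiff ℝ (⊤ : ℕ∞) v) :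
    IntegrableOn (fun x => (γ x).mulVec (grad u x) ⬝ᵥ grad v x) Ω :=
  ((hγ.continuousOn_form continuousOn_id (mapsTo_id _) (continuous_grad hu).continuousOn
    (continuous_grad hv).continuousOn).integrableOn_compact hΩb.isCompact_closure).mono_set
      subset_closure

lemma Continuous.integrableOn_of_isBounded {f : (Fin n → ℝ) → ℝ} (hf : Continuous f)
    (hΩb : Bornology.IsBounded Ω) : IntegrableOn f Ω :=
  (hf.continuousOn.integrableOn_compact hΩb.isCompact_closure).mono_set subset_closure

lemma integral_add_mul_add_mul {f g h : (Fin n → ℝ) → ℝ} (hf : IntegrableOn f Ω)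
    (hg : IntegrableOn g Ω) (hh : IntegrableOn h Ω) (a b : ℝ) :
    ∫ x in Ω, (f x + a * g x + b * h x) =
      (∫ x in Ω, f x) + a * (∫ x in Ω, g x) + b * ∫ x in Ω, h x := by
  rw [← integral_const_mul, ← integral_const_mul, ← integral_add hf (hg.const_mul a)]
  exact integral_add (hf.add (hg.const_mul a)) (hh.const_mul b)

lemma Qform_const_mul (hu : Differentiable ℝ u) (t : ℝ) :
    Qform Ω γ (fun x => t * u x) = t ^ 2 * Qform Ω γ u := by
  simp only [Qform, grad_const_mul hu, ← integral_const_mul]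
  congr 1 with x
  simp only [mulVec_smul, smul_dotProduct, dotProduct_smul, smul_eq_mul]
  ring

lemma Qform_add_const_mul (hΩb : Bornology.IsBounded Ω) (hγ : IsConductivityOn γ (closure Ω))
    (hu : ContDiff ℝ (⊤ : ℕ∞) u) (hv : ContDiff ℝ (⊤ : ℕ∞) v) (t : ℝ) :
    Qform Ω γ (fun x => u x + t * v x) = Qform Ω γ u +
      t * ((∫ x in Ω, (γ x).mulVec (grad u x) ⬝ᵥ grad v x) +
        ∫ x in Ω, (γ x).mulVec (grad v x) ⬝ᵥ grad u x) + t ^ 2 * Qform Ω γ v := by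
  have huu := integrableOn_form hΩb hγ hu hu
  have huv := integrableOn_form hΩb hγ hu hv
  have hvu := integrableOn_form hΩb hγ hv hu
  have hvv := integrableOn_form hΩb hγ hv hv
  simp only [Qform]
  rw [← integral_add huv hvu]
  refine Eq.trans ?_ (integral_add_mul_add_mul huu (huv.add hvu) hvv t (t ^ 2))
  rw [grad_add_const_mul (hu.differentiable (by simp)) (hv.differentiable (by simp))]
  congr 1 with x
  simp only [mulVec_add, mulVec_smul, add_dotProduct, dotProduct_add, smul_dotProduct,
    dotProduct_smul, smul_eq_mul, Pi.add_apply]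
  ring

lemma integral_sq_add_const_mul (hΩb : Bornology.IsBounded Ω) (hu : Continuous u)
    (hv : Continuous v) (t : ℝ) :
    ∫ x in Ω, (u x + t * v x) ^ 2 =
      (∫ x in Ω, u x ^ 2) + t * (2 * ∫ x in Ω, u x * v x) + t ^ 2 * ∫ x in Ω, v x ^ 2 := by
  have huu := (hu.pow 2).integrableOn_of_isBounded hΩb
  have huv := (hu.mul hv).integrableOn_of_isBounded hΩb
  have hvv := (hv.pow 2).integrableOn_of_isBounded hΩb
  rw [← integral_const_mul]
  refine Eq.trans ?_ (integral_add_mul_add_mul huu (huv.const_mul 2) hvv t (t ^ 2))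
  congr 1 with x
  simp only [Pi.mul_apply, Pi.pow_apply]
  ring

lemma integral_comp_smul_sub (f : (Fin n → ℝ) → ℝ) {k : ℝ} (hk : 0 < k) (x₀ : Fin n → ℝ) :
    ∫ x, f (k • (x - x₀)) = (k ^ n)⁻¹ * ∫ x, f x := by
  rw [integral_sub_right_eq_self (fun x => f (k • x)) x₀, Measure.integral_comp_smul]
  simp [abs_of_pos (pow_pos hk n)]

/-- The Dirichlet form is unbounded above on `X_∞`: concentrate a given element at a point. -/
lemma exists_memXinf_lt_Qform (hn : 0 < n) (hΩo : IsOpen Ω) (hΩb : Bornology.IsBounded Ω)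
    (hΩne : Ω.Nonempty) (hγ : IsConductivityOn γ (closure Ω)) (hu : MemXinf Ω u) (lam : ℝ) :
    ∃ v, MemXinf Ω v ∧ lam < Qform Ω γ v := by
  obtain ⟨hsm, hcs, hsupp, hsq, hmean⟩ := hu
  have hud : Differentiable ℝ u := hsm.differentiable (by simp)
  obtain ⟨x₀, hx₀⟩ := hΩne
  obtain ⟨ε, hε, hball⟩ := Metric.nhds_basis_closedBall.mem_iff.mp (hΩo.mem_nhds hx₀)
  obtain ⟨R, hR⟩ := hΩb.subset_closedBall (0 : Fin n → ℝ)
  obtain ⟨c, hc, hcγ⟩ := hγ.exists_lower_bound hΩb.isCompact_closure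
  have hne : u ≠ 0 := by
    rintro rfl
    simp at hsq
  have hI := integral_norm_grad_sq_pos hn hsm hcs hne
  set I := ∫ x, ‖grad u x‖ ^ 2 with hIdef
  obtain ⟨k, hk1, hkR, hkl⟩ : ∃ k : ℝ, 1 ≤ k ∧ R / ε ≤ k ∧ lam / (c * I) < k :=
    ((eventually_ge_atTop 1).and ((eventually_ge_atTop _).and (eventually_gt_atTop _))).exists
  have hk : 0 < k := by linarith
  have hzero : ∀ f : (Fin n → ℝ) → ℝ, (∀ x ∉ Ω, f x = 0) → ∫ x in Ω, f x = ∫ x, f x :=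
    fun f hf => setIntegral_eq_integral_of_forall_compl_eq_zero hf
  set α := Real.sqrt (k ^ n) with hα
  have hα2 : α ^ 2 = k ^ n := Real.sq_sqrt (by positivity)
  set w : (Fin n → ℝ) → ℝ := fun x => u (k • (x - x₀)) with hw
  set v : (Fin n → ℝ) → ℝ := fun x => α * w x with hv
  have hwsm : ContDiff ℝ (⊤ : ℕ∞) w :=
    hsm.comp ((contDiff_id.sub contDiff_const).const_smul k)
  have hwd : Differentiable ℝ w := hwsm.differentiable (by simp)
  have hwsupp : Function.support w ⊆ Metric.closedBall x₀ ε := by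
    intro x hx
    have h := hR (hsupp (subset_tsupport _ hx))
    rw [mem_closedBall_zero_iff, norm_smul, Real.norm_of_nonneg hk.le] at h
    rw [mem_closedBall_iff_norm]
    rw [div_le_iff₀ hε] at hkR
    exact le_of_mul_le_mul_left (h.trans hkR) hk
  have hvsupp : Function.support v ⊆ Metric.closedBall x₀ ε :=
    (Function.support_mul_subset_right _ _).trans hwsupp
  have hvt : tsupport v ⊆ Ω := (closure_minimal hvsupp Metric.isClosed_closedBall).trans hball
  have hwt : tsupport w ⊆ Ω := (closure_minimal hwsupp Metric.isClosed_closedBall).trans hball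
  have hu0 : ∀ x ∉ Ω, u x = 0 := fun x hx =>
    image_eq_zero_of_notMem_tsupport fun h => hx (hsupp h)
  have hv0 : ∀ x ∉ Ω, v x = 0 := fun x hx =>
    image_eq_zero_of_notMem_tsupport fun h => hx (hvt h)
  rw [hzero _ fun x hx => by simp [hu0 x hx]] at hsq hmean
  refine ⟨v, ⟨contDiff_const.mul hwsm,
    HasCompactSupport.of_support_subset_isCompact (isCompact_closedBall x₀ ε) hvsupp,
    hvt, ?_, ?_⟩, ?_⟩
  · rw [hzero _ fun x hx => by simp [hv0 x hx]]
    simp only [hv, hw, mul_pow, integral_const_mul]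
    rw [integral_comp_smul_sub (fun x => u x ^ 2) hk, hsq, hα2]
    field_simp
  · rw [hzero _ hv0]
    simp only [hv, hw, integral_const_mul]
    rw [integral_comp_smul_sub u hk, hmean]
    simp
  · have hgw : ∫ x in Ω, ‖grad w x‖ ^ 2 = k ^ 2 * ((k ^ n)⁻¹ * I) := by
      rw [hzero]
      · simp only [hw, grad_comp_smul_sub hud, norm_smul, Real.norm_of_nonneg hk.le, mul_pow,
          integral_const_mul]
        rw [integral_comp_smul_sub (fun x => ‖grad u x‖ ^ 2) hk]
      · intro x hx
        have : grad w x = 0 := by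
          by_contra h
          exact hx (hwt (support_grad_subset h))
        simp [this]
    have hle : c * ∫ x in Ω, ‖grad w x‖ ^ 2 ≤ Qform Ω γ w := by
      rw [← integral_const_mul]
      exact setIntegral_mono_on
        ((((continuous_grad hwsm).norm.pow 2).integrableOn_of_isBounded hΩb).const_mul c)
        (integrableOn_form hΩb hγ hwsm hwsm) hΩo.measurableSet
        fun x hx => hcγ x (subset_closure hx) _
    rw [Qform_const_mul hwd, hα2]
    rw [div_lt_iff₀ (by positivity)] at hkl
    have hcI : 0 < c * I := by positivity
    calc lam < k * (c * I) := hkl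
      _ ≤ k ^ 2 * (c * I) := by gcongr; nlinarith
      _ = k ^ n * (c * (k ^ 2 * ((k ^ n)⁻¹ * I))) := by field_simp
      _ ≤ k ^ n * Qform Ω γ w := by
        rw [← hgw]
        gcongr

end Conductivity

/-- Every value `λ ≥ Q_γ(u₀)` with `u₀ ∈ X_∞` is attained by the
Dirichlet form on `X_∞`. -/
theorem numericalRange_ray
    {n : ℕ} (hn : 3 ≤ n) (Ω : Set (Fin n → ℝ)) (hΩo : IsOpen Ω)
    (hΩb : Bornology.IsBounded Ω) (hΩne : Ω.Nonempty)
    (γ : (Fin n → ℝ) → Matrix (Fin n) (Fin n) ℝ)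
    (hγ : IsConductivityOn γ (closure Ω)) :
    ∀ u₀, MemXinf Ω u₀ → ∀ lam : ℝ, Qform Ω γ u₀ ≤ lam →
      ∃ u, MemXinf Ω u ∧ Qform Ω γ u = lam := by
  intro u hu lam hlam
  rcases hlam.eq_or_lt with heq | hlt
  · exact ⟨u, hu, heq⟩
  obtain ⟨v, hv, hlv⟩ := exists_memXinf_lt_Qform (by omega) hΩo hΩb hΩne hγ hu lam
  obtain ⟨husm, hucs, husupp, husq, humean⟩ := hu
  obtain ⟨hvsm, hvcs, hvsupp, hvsq, hvmean⟩ := hv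
  have hQ := Qform_add_const_mul hΩb hγ husm hvsm
  have hN := integral_sq_add_const_mul hΩb husm.continuous hvsm.continuous
  rw [husq, hvsq] at hN
  set b := (∫ x in Ω, (γ x).mulVec (grad u x) ⬝ᵥ grad v x) +
        ∫ x in Ω, (γ x).mulVec (grad v x) ⬝ᵥ grad u x
  set d := ∫ x in Ω, u x * v x
  obtain ⟨t, htd, ht⟩ := exists_root_of_neg_of_pos (b := b - 2 * lam * d)
    (sub_pos.mpr hlv) (sub_neg.mpr hlt) d
  set w : (Fin n → ℝ) → ℝ := fun x => u x + t * v x with hw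
  set N := ∫ x in Ω, w x ^ 2 with hNdef
  have hNt : N = 1 + t * (2 * d) + t ^ 2 * 1 := hN t
  have hNpos : 0 < N := by nlinarith [sq_nonneg t]
  have hQw : Qform Ω γ w = lam * N := by
    rw [hQ t, hNt]
    linear_combination ht
  have hwsm : ContDiff ℝ (⊤ : ℕ∞) w := husm.add (contDiff_const.mul hvsm)
  have hs : ((Real.sqrt N)⁻¹) ^ 2 = N⁻¹ := by rw [inv_pow, Real.sq_sqrt hNpos.le]
  have hvt : tsupport (fun x => t * v x) ⊆ tsupport v := tsupport_mul_subset_right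
  have hwt : tsupport w ⊆ tsupport u ∪ tsupport v :=
    (tsupport_add u fun x => t * v x).trans (union_subset_union_right _ hvt)
  have hwcs : HasCompactSupport w := hucs.add hvcs.mul_left
  refine ⟨fun x => (Real.sqrt N)⁻¹ * w x, ⟨contDiff_const.mul hwsm, hwcs.mul_left,
    tsupport_mul_subset_right.trans (hwt.trans (union_subset husupp hvsupp)), ?_, ?_⟩, ?_⟩
  · simp only [mul_pow, integral_const_mul, hs]
    exact inv_mul_cancel₀ hNpos.ne'
  · rw [integral_const_mul, hw, integral_add (husm.continuous.integrableOn_of_isBounded hΩb)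
      ((hvsm.continuous.integrableOn_of_isBounded hΩb).const_mul t), integral_const_mul,
      humean, hvmean]
    simp
  · rw [Qform_const_mul (hwsm.differentiable (by simp)), hQw, hs]
    field_simp
end
end

section
/- Let Ω ⊂ ℝⁿ (n ≥ 3) be a bounded open set, let β be a conductivity on the closure of Ω, let c be a continuous positive function on the closure of Ω, and let Ψ ∈ SDiff of the closure of Ω. If ∫_Ω c(x)^{2n/(n−2)} (det β(x))^{1/(n−2)} dx ≠ ∫_Ω (det β(x))^{1/(n−2)} dx, then the conductivities c²β and Ψ_*β are not isometric: there is no Φ ∈ SDiff such that c²β = Φ_*(Ψ_*β). -/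
open MeasureTheory Matrix Set Filter
open scoped Topology

noncomputable section

/-- `SDiff`: a smooth diffeomorphism of the closure of `Ω` onto itself which is the
identity on `∂Ω` and volume preserving (`|det DΨ| = 1` on `Ω`). -/
structure SDiffOn {n : ℕ} (Ω : Set (Fin n → ℝ)) extends DiffeoOn (⊤ : ℕ∞) Ω where
  boundary_id : ∀ x ∈ frontier Ω, toFun x = x
  unimodular : ∀ x ∈ Ω, |(Jac toFun x).det| = 1

theorem jac_eq_toMatrix' {n : ℕ} {f : (Fin n → ℝ) → (Fin n → ℝ)} {x : Fin n → ℝ}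
    (hf : DifferentiableAt ℝ f x) :
    Jac f x = LinearMap.toMatrix' (fderiv ℝ f x : (Fin n → ℝ) →ₗ[ℝ] (Fin n → ℝ)) := by
  ext i j
  have h := hasFDerivAt_pi'.1 hf.hasFDerivAt i
  simp [Jac, h.fderiv, LinearMap.toMatrix'_apply]

theorem det_pushforward {n : ℕ} {Ψ Φ : (Fin n → ℝ) → (Fin n → ℝ)}
    (γ : (Fin n → ℝ) → Matrix (Fin n) (Fin n) ℝ) {y : Fin n → ℝ}
    (h : |(Jac Ψ (Φ y)).det| = 1) :
    (pushforward Ψ Φ γ y).det = (γ (Φ y)).det := by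
  have h2 : (Jac Ψ (Φ y)).det * (Jac Ψ (Φ y)).det = 1 := by
    rw [← abs_mul_abs_self, h, one_mul]
  simp only [pushforward, h, inv_one, one_smul, det_mul, det_transpose]
  rw [mul_right_comm, h2, one_mul]

namespace SDiffOn

variable {n : ℕ} {Ω : Set (Fin n → ℝ)}

theorem invFun_mem (Φ : SDiffOn Ω) {y : Fin n → ℝ} (hy : y ∈ Ω) : Φ.invFun y ∈ Ω := by
  rw [← Φ.image_eq] at hy
  obtain ⟨x, hx, rfl⟩ := hy
  rwa [Φ.left_inv x (subset_closure hx)]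

theorem differentiableAt (Φ : SDiffOn Ω) (hΩ : IsOpen Ω) {x : Fin n → ℝ} (hx : x ∈ Ω) :
    DifferentiableAt ℝ Φ.toFun x :=
  (Φ.contDiffOn_toFun.contDiffAt
    (mem_of_superset (hΩ.mem_nhds hx) subset_closure)).differentiableAt (by simp)

theorem abs_det_fderiv (Φ : SDiffOn Ω) (hΩ : IsOpen Ω) {x : Fin n → ℝ} (hx : x ∈ Ω) :
    |(fderiv ℝ Φ.toFun x).det| = 1 := by
  have h := Φ.unimodular x hx
  rwa [jac_eq_toMatrix' (Φ.differentiableAt hΩ hx), LinearMap.det_toMatrix'] at h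

/-- Volume-preserving diffeomorphisms preserve integrals. -/
theorem setIntegral_comp_invFun (Φ : SDiffOn Ω) (hΩ : IsOpen Ω) (h : (Fin n → ℝ) → ℝ) :
    ∫ y in Ω, h (Φ.invFun y) = ∫ x in Ω, h x := by
  have hinj : InjOn Φ.toFun Ω := fun a ha b hb hab => by
    rw [← Φ.left_inv a (subset_closure ha), hab, Φ.left_inv b (subset_closure hb)]
  have key := integral_image_eq_integral_abs_det_fderiv_smul volume hΩ.measurableSet
    (fun x hx => (Φ.differentiableAt hΩ hx).hasFDerivAt.hasFDerivWithinAt) hinj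
    (fun y => h (Φ.invFun y))
  rw [Φ.image_eq] at key
  rw [key]
  refine setIntegral_congr_fun hΩ.measurableSet fun x hx => ?_
  simp only [Φ.abs_det_fderiv hΩ hx, one_smul, Φ.left_inv x (subset_closure hx)]

end SDiffOn

/-- If `∫_Ω c^{2n/(n−2)} (det β)^{1/(n−2)} ≠ ∫_Ω (det β)^{1/(n−2)}`,
then the conductivities `c²β` and `Ψ_*β` are not isometric: there is no `Φ ∈ SDiff`
with `c²β = Φ_*(Ψ_*β)`. -/
theorem conductivities_not_isometric
    {n : ℕ} (hn : 3 ≤ n) (Ω : Set (Fin n → ℝ)) (hΩo : IsOpen Ω)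
    (hΩb : Bornology.IsBounded Ω)
    (β : (Fin n → ℝ) → Matrix (Fin n) (Fin n) ℝ)
    (hβ : IsConductivityOn β (closure Ω))
    (c : (Fin n → ℝ) → ℝ) (hc : ContinuousOn c (closure Ω))
    (hcpos : ∀ x ∈ closure Ω, 0 < c x)
    (Ψ : SDiffOn Ω)
    (hne : ∫ x in Ω, c x ^ ((2 * n : ℝ) / ((n : ℝ) - 2)) * (β x).det ^ (1 / ((n : ℝ) - 2))
      ≠ ∫ x in Ω, (β x).det ^ (1 / ((n : ℝ) - 2))) :
    ¬ ∃ Φ : SDiffOn Ω, ∀ y ∈ Ω,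
        c y ^ 2 • β y
          = pushforward Φ.toFun Φ.invFun (pushforward Ψ.toFun Ψ.invFun β) y := by
  rintro ⟨Φ, hΦ⟩
  refine hne ?_
  have hpt : ∀ y ∈ Ω,
      c y ^ ((2 * n : ℝ) / ((n : ℝ) - 2)) * (β y).det ^ (1 / ((n : ℝ) - 2))
        = (β (Ψ.invFun (Φ.invFun y))).det ^ (1 / ((n : ℝ) - 2)) := by
    intro y hy
    have hcy := hcpos y (subset_closure hy)
    have hdet := congrArg Matrix.det (hΦ y hy)
    rw [det_pushforward _ (Φ.unimodular _ (Φ.invFun_mem hy)),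
      det_pushforward _ (Ψ.unimodular _ (Ψ.invFun_mem (Φ.invFun_mem hy))),
      det_smul, Fintype.card_fin, ← pow_mul] at hdet
    rw [← hdet, Real.mul_rpow (by positivity) (hβ.2 y (subset_closure hy)).2.det_pos.le,
      ← Real.rpow_natCast, ← Real.rpow_mul hcy.le]
    congr 2
    push_cast
    ring
  rw [setIntegral_congr_fun hΩo.measurableSet hpt,
    Φ.setIntegral_comp_invFun hΩo fun x => (β (Ψ.invFun x)).det ^ (1 / ((n : ℝ) - 2)),
    Ψ.setIntegral_comp_invFun hΩo fun x => (β x).det ^ (1 / ((n : ℝ) - 2))]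
end
end
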